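/- Equivalence of interlacing and Wronskian nonvanishing: for real orders ν ≥ 0 and μ ≥ 0 with ν ≠ μ, the inequalities y_{μ,s} < j_{ν,s} < y_{μ,s+1} < j_{ν,s+1} hold for every integer s ≥ 1 if and only if the mixed Wronskian W_{νμ}(x) = J_ν(x)·Y′_μ(x) − J′_ν(x)·Y_μ(x) is nonzero for every x ∈ (0, ∞). -/

import Mathlib

open Real Filter

/-- Bessel function of the first kind of real order `ν`:
`J_ν(x) = Σ_{k=0}^∞ ((−1)^k / (k! · Γ(ν+k+1))) · (x/2)^{ν+2k}`. -/
noncomputable def besselJ (ν : ℝ) (x : ℝ) : ℝ :=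
  ∑' k : ℕ, ((-1 : ℝ) ^ k / ((k.factorial : ℝ) * Real.Gamma (ν + k + 1))) *
    (x / 2) ^ (ν + 2 * (k : ℝ))

/-- Bessel function of the second kind of real order `ν`, defined as the limit
`Y_ν(x) = lim_{μ→ν, μ ∉ ℤ} (J_μ(x)·cos(μπ) − J_{−μ}(x)) / sin(μπ)`. -/
noncomputable def besselY (ν : ℝ) (x : ℝ) : ℝ :=
  limUnder (nhdsWithin ν {μ : ℝ | ∀ n : ℤ, μ ≠ (n : ℝ)})
    fun μ => (besselJ μ x * Real.cos (μ * π) - besselJ (-μ) x) / Real.sin (μ * π)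

/-- `z s`, for integers `s ≥ 1`, enumerates all the positive real zeros of `f`
in strictly increasing order. -/
structure IsPosZeroSeq (f : ℝ → ℝ) (z : ℕ → ℝ) : Prop where
  pos : ∀ s, 1 ≤ s → 0 < z s
  mono : ∀ s t, 1 ≤ s → s < t → z s < z t
  isZero : ∀ s, 1 ≤ s → f (z s) = 0
  complete : ∀ x, 0 < x → f x = 0 → ∃ s, 1 ≤ s ∧ z s = x

/-- `z s`, for integers `s ≥ 1`, enumerates the zeros `j'_{ν,s}` of `J'_ν`
(increasingly), with the convention that `x = 0` is counted as the first zero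
`j'_{0,1}` of `J'_0`. -/
def IsBesselJDerivZeroSeq (ν : ℝ) (z : ℕ → ℝ) : Prop :=
  (ν = 0 → z 1 = 0 ∧ IsPosZeroSeq (deriv (besselJ 0)) fun s => z (s + 1)) ∧
  (ν ≠ 0 → IsPosZeroSeq (deriv (besselJ ν)) z)

open Set Topology

/-- The entire function `t ↦ 1 / Γ(t + 1)` on the real line. -/
noncomputable def invGamma (t : ℝ) : ℝ := (Real.Gamma (t + 1))⁻¹

theorem invGamma_eq (t : ℝ) : invGamma t = (t + 1) * invGamma (t + 1) := by
  unfold invGamma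
  rcases eq_or_ne (t + 1) 0 with h | h
  · simp [h, Real.Gamma_zero]
  · rw [Real.Gamma_add_one h, mul_inv, mul_inv_cancel_left₀ h]

theorem invGamma_pos {t : ℝ} (ht : 0 ≤ t) : 0 < invGamma t :=
  inv_pos.2 (Real.Gamma_pos_of_pos (by linarith))

theorem contDiff_invGamma : ContDiff ℝ 2 invGamma := by
  have h1 : ContDiff ℂ 2 (fun s : ℂ => (Complex.Gamma (s + 1))⁻¹) :=
    Differentiable.contDiff (Complex.differentiable_one_div_Gamma.comp (by fun_prop))
  have h2 : invGamma = fun t : ℝ => ((fun s : ℂ => (Complex.Gamma (s + 1))⁻¹) t).re := by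
    funext t
    have : Complex.Gamma ((t : ℂ) + 1) = ((Real.Gamma (t + 1) : ℝ) : ℂ) := by
      rw [← Complex.Gamma_ofReal]; push_cast; rfl
    simp only [this, invGamma, ← Complex.ofReal_inv, Complex.ofReal_re]
  rw [h2, contDiff_iff_contDiffAt]
  exact fun t => h1.contDiffAt.real_of_complex

theorem hasDerivAt_invGamma (t : ℝ) : HasDerivAt invGamma (deriv invGamma t) t :=
  (contDiff_invGamma.differentiable (by norm_num) t).hasDerivAt

theorem deriv_invGamma_eq (t : ℝ) :
    deriv invGamma t = invGamma (t + 1) + (t + 1) * deriv invGamma (t + 1) := by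
  have h1 : HasDerivAt (fun s => (s + 1) * invGamma (s + 1))
      (1 * invGamma (t + 1) + (t + 1) * deriv invGamma (t + 1)) t :=
    ((hasDerivAt_id t).add_const 1).mul ((hasDerivAt_invGamma (t + 1)).comp_add_const t 1)
  rw [← funext invGamma_eq] at h1
  rw [h1.deriv, one_mul]

/-- At most geometric growth along the translates `t, t + 1, t + 2, …`, locally uniformly
in `t`. -/
def GeomGrowth (c : ℝ → ℝ) : Prop :=
  ∀ R : ℝ, ∃ M : ℝ, 0 ≤ M ∧ ∀ t, |t| ≤ R → ∀ k : ℕ, |c (t + k)| ≤ M * 2 ^ k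

theorem invGamma_growth (R : ℝ) : ∃ M : ℝ, 0 ≤ M ∧ ∀ t, |t| ≤ R → ∀ k : ℕ,
    |invGamma (t + k)| + |deriv invGamma (t + k)| ≤ M * 2 ^ k := by
  have hcont : Continuous fun t => |invGamma t| + |deriv invGamma t| :=
    contDiff_invGamma.continuous.abs.add (contDiff_invGamma.continuous_deriv (by norm_num)).abs
  obtain ⟨M, hM⟩ := (isCompact_Icc (a := -R) (b := |R| + 1)).exists_bound_of_continuousOn
    hcont.continuousOn
  refine ⟨|M|, abs_nonneg M, fun t ht k => ?_⟩
  have base : ∀ s, -R ≤ s → s ≤ |R| + 1 → |invGamma s| + |deriv invGamma s| ≤ |M| := by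
    intro s h1 h2
    exact (le_abs_self _).trans ((hM s ⟨h1, h2⟩).trans (le_abs_self M))
  have ht' := abs_le.1 ht
  have hR := le_abs_self R
  induction k with
  | zero => simpa using base t ht'.1 (by linarith)
  | succ k ih =>
    rcases le_total (t + (k + 1 : ℕ)) (|R| + 1) with h | h
    · refine (base _ ?_ h).trans (le_mul_of_one_le_right (abs_nonneg M) (one_le_pow₀ (by norm_num)))
      have : (0 : ℝ) ≤ (k + 1 : ℕ) := by positivity
      linarith [ht'.1]
    · push_cast at h ⊢
      have hs : 0 ≤ t + k := by linarith [abs_nonneg R]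
      set s := t + (k : ℝ) with hsdef
      rw [← add_assoc, ← hsdef]
      have e1 := invGamma_eq s
      have e2 := deriv_invGamma_eq s
      have h1 : |invGamma (s + 1)| ≤ |invGamma s| := by
        rw [e1, abs_mul, abs_of_nonneg (by linarith : 0 ≤ s + 1)]
        exact le_mul_of_one_le_left (abs_nonneg _) (by linarith)
      have h2 : |deriv invGamma (s + 1)| ≤ |deriv invGamma s| + |invGamma (s + 1)| := by
        calc |deriv invGamma (s + 1)| ≤ (s + 1) * |deriv invGamma (s + 1)| :=
              le_mul_of_one_le_left (abs_nonneg _) (by linarith)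
          _ = |deriv invGamma s - invGamma (s + 1)| := by
              rw [e2, add_sub_cancel_left, abs_mul, abs_of_nonneg (by linarith : 0 ≤ s + 1)]
          _ ≤ _ := abs_sub _ _
      rw [pow_succ]
      linarith [abs_nonneg (deriv invGamma s)]

theorem geomGrowth_invGamma : GeomGrowth invGamma := fun R =>
  (invGamma_growth R).imp fun _ ⟨h0, h⟩ => ⟨h0, fun t ht k =>
    (le_add_of_nonneg_right (abs_nonneg _)).trans (h t ht k)⟩

theorem geomGrowth_deriv_invGamma : GeomGrowth (deriv invGamma) := fun R =>
  (invGamma_growth R).imp fun _ ⟨h0, h⟩ => ⟨h0, fun t ht k =>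
    (le_add_of_nonneg_left (abs_nonneg _)).trans (h t ht k)⟩

/-- The series `∑ c(a + k) (-w)^k / k!`. -/
noncomputable def shiftSeries (c : ℝ → ℝ) (a w : ℝ) : ℝ :=
  ∑' k : ℕ, c (a + k) * ((-w) ^ k / (k.factorial : ℝ))

theorem abs_shiftSeries_term_le {c : ℝ → ℝ} {M t w r : ℝ} (k : ℕ)
    (h : |c (t + k)| ≤ M * 2 ^ k) (hw : |w| ≤ r) :
    |c (t + k) * ((-w) ^ k / (k.factorial : ℝ))| ≤ M * ((2 * r) ^ k / (k.factorial : ℝ)) := by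
  have hw' : |w| ^ k ≤ r ^ k := pow_le_pow_left₀ (abs_nonneg w) hw k
  have hk : (0 : ℝ) < k.factorial := by positivity
  rw [abs_mul, abs_div, abs_pow, abs_neg, abs_of_pos hk, mul_pow]
  calc |c (t + k)| * (|w| ^ k / k.factorial)
      ≤ (M * 2 ^ k) * (r ^ k / k.factorial) := by
        gcongr
        exact (abs_nonneg _).trans h
    _ = M * (2 ^ k * r ^ k / k.factorial) := by ring

theorem GeomGrowth.summable {c : ℝ → ℝ} (hc : GeomGrowth c) (a w : ℝ) :
    Summable fun k : ℕ => c (a + k) * ((-w) ^ k / (k.factorial : ℝ)) := by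
  obtain ⟨M, -, hM⟩ := hc |a|
  exact Summable.of_norm_bounded ((Real.summable_pow_div_factorial (2 * |w|)).mul_left M)
    fun k => abs_shiftSeries_term_le k (hM a le_rfl k) le_rfl

theorem hasDerivAt_shiftSeries {c : ℝ → ℝ} (hc : GeomGrowth c) (a w : ℝ) :
    HasDerivAt (shiftSeries c a) (-shiftSeries c (a + 1) w) w := by
  obtain ⟨M, hM0, hM⟩ := hc |a|
  set r := |w| + 1
  have hsucc : ∀ (k : ℕ) (v : ℝ),
      c (a + (k + 1 : ℕ)) * (((k + 1 : ℕ) * (-v) ^ (k + 1 - 1) * -1) / ((k + 1).factorial : ℝ)) =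
        -(c (a + 1 + k) * ((-v) ^ k / (k.factorial : ℝ))) := by
    intro k v
    have hk : (k.factorial : ℝ) ≠ 0 := by positivity
    have hk1 : (k : ℝ) + 1 ≠ 0 := by positivity
    rw [Nat.factorial_succ, Nat.add_sub_cancel,
      show a + ((k + 1 : ℕ) : ℝ) = a + 1 + k by push_cast; ring]
    push_cast
    field_simp
  have hu : Summable fun k : ℕ =>
      M * 2 ^ k * ((k : ℝ) * r ^ (k - 1) / (k.factorial : ℝ)) := by
    rw [← summable_nat_add_iff 1]
    refine ((Real.summable_pow_div_factorial (2 * r)).mul_left (2 * M)).congr fun k => ?_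
    have hk : (k.factorial : ℝ) ≠ 0 := by positivity
    have hk1 : (k : ℝ) + 1 ≠ 0 := by positivity
    rw [Nat.factorial_succ, Nat.add_sub_cancel, mul_pow]
    push_cast
    field_simp
    ring
  have key := hasDerivAt_tsum_of_isPreconnected (t := Metric.ball (0 : ℝ) r) (y₀ := 0) (y := w)
    (g := fun (k : ℕ) (v : ℝ) => c (a + k) * ((-v) ^ k / (k.factorial : ℝ)))
    (g' := fun (k : ℕ) (v : ℝ) =>
      c (a + k) * ((k * (-v) ^ (k - 1) * -1) / (k.factorial : ℝ)))
    hu Metric.isOpen_ball (convex_ball (0 : ℝ) r).isPreconnected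
    (fun k v _ => ((((hasDerivAt_neg v).pow k).div_const _).const_mul _))
    (fun k v hv => by
      have hv' : |v| ≤ r := by simpa using (mem_ball_zero_iff.1 hv).le
      have hk : (0 : ℝ) < k.factorial := by positivity
      rw [Real.norm_eq_abs, abs_mul, abs_div, abs_mul, abs_mul, abs_pow, abs_neg, abs_neg, abs_one,
        mul_one, abs_of_pos hk, abs_of_nonneg (Nat.cast_nonneg k : (0 : ℝ) ≤ k)]
      have := hM a le_rfl k
      gcongr)
    (by simpa [r] using (by positivity : 0 < |w| + 1)) (hc.summable a 0)
    (by simp [r])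
  refine key.congr_deriv ?_
  rw [tsum_eq_zero_add' (by simpa only [hsucc] using (hc.summable (a + 1) w).neg)]
  simp only [hsucc, tsum_neg, shiftSeries]
  simp

theorem hasDerivAt_shiftSeries_param {c c' : ℝ → ℝ} (hc : GeomGrowth c) (hc' : GeomGrowth c')
    (hd : ∀ t, HasDerivAt c (c' t) t) (a w : ℝ) :
    HasDerivAt (fun b => shiftSeries c b w) (shiftSeries c' a w) a := by
  obtain ⟨M, hM0, hM⟩ := hc' (|a| + 1)
  exact hasDerivAt_tsum_of_isPreconnected (t := Metric.ball (0 : ℝ) (|a| + 1)) (y₀ := a) (y := a)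
    (g := fun (k : ℕ) (b : ℝ) => c (b + k) * ((-w) ^ k / (k.factorial : ℝ)))
    (g' := fun (k : ℕ) (b : ℝ) => c' (b + k) * ((-w) ^ k / (k.factorial : ℝ)))
    ((Real.summable_pow_div_factorial (2 * |w|)).mul_left M) Metric.isOpen_ball
    (convex_ball (0 : ℝ) _).isPreconnected
    (fun k b _ => ((hd (b + k)).comp_add_const b (k : ℝ)).mul_const _)
    (fun k b hb => abs_shiftSeries_term_le k
      (hM b (by simpa using (mem_ball_zero_iff.1 hb).le) k) le_rfl)
    (by simp) (hc.summable a w) (by simp)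

theorem shiftSeries_zero (c : ℝ → ℝ) (a : ℝ) : shiftSeries c a 0 = c a := by
  unfold shiftSeries
  rw [tsum_eq_single 0 fun k hk => by simp [hk]]
  simp

/-- The contiguous relation of the series `₀F₁`. -/
theorem shiftSeries_invGamma_eq (a w : ℝ) :
    shiftSeries invGamma a w =
      (a + 1) * shiftSeries invGamma (a + 1) w - w * shiftSeries invGamma (a + 2) w := by
  have s0 := geomGrowth_invGamma.summable a w
  have s1 := (geomGrowth_invGamma.summable (a + 1) w).mul_left (a + 1)
  have s2 := (geomGrowth_invGamma.summable (a + 2) w).mul_left (-w)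
  have hdiff := s0.sub s1
  have hterm : ∀ k : ℕ, invGamma (a + (k + 1 : ℕ)) * ((-w) ^ (k + 1) / ((k + 1).factorial : ℝ)) -
      (a + 1) * (invGamma (a + 1 + (k + 1 : ℕ)) * ((-w) ^ (k + 1) / ((k + 1).factorial : ℝ))) =
      -w * (invGamma (a + 2 + k) * ((-w) ^ k / (k.factorial : ℝ))) := by
    intro k
    have hk : (k.factorial : ℝ) ≠ 0 := by positivity
    have hk1 : (k : ℝ) + 1 ≠ 0 := by positivity
    have e := invGamma_eq (a + (k + 1 : ℕ))
    rw [e, show a + 1 + ((k + 1 : ℕ) : ℝ) = a + 2 + k by push_cast; ring,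
      show a + ((k + 1 : ℕ) : ℝ) + 1 = a + 2 + k by push_cast; ring, Nat.factorial_succ]
    push_cast
    field_simp
    ring
  have h := hdiff.tsum_eq_zero_add
  simp only [hterm] at h
  rw [s0.tsum_sub s1, tsum_mul_left, tsum_mul_left] at h
  have e := invGamma_eq a
  simp only [Nat.cast_zero, add_zero, pow_zero, Nat.factorial_zero, Nat.cast_one, div_one,
    mul_one] at h
  unfold shiftSeries
  linear_combination h + e

theorem shiftSeries_deriv_invGamma_eq (a w : ℝ) :
    shiftSeries (deriv invGamma) a w =
      shiftSeries invGamma (a + 1) w + (a + 1) * shiftSeries (deriv invGamma) (a + 1) w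
        - w * shiftSeries (deriv invGamma) (a + 2) w := by
  have hd := fun b => hasDerivAt_shiftSeries_param geomGrowth_invGamma geomGrowth_deriv_invGamma
    hasDerivAt_invGamma b w
  have h := (((hasDerivAt_id a).add_const 1).mul ((hd (a + 1)).comp_add_const a 1)).sub
    (((hd (a + 2)).comp_add_const a 2).const_mul w)
  have h' := (hd a).unique (h.congr_of_eventuallyEq
    (Eventually.of_forall fun b => shiftSeries_invGamma_eq b w))
  simpa using h'

theorem shiftSeries_wronskian (a w : ℝ) :
    w * shiftSeries invGamma (a + 1) w * shiftSeries invGamma (-a) w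
      + shiftSeries invGamma a w * shiftSeries invGamma (-a - 1) w = -(Real.sin (a * π) / π) := by
  set Q : ℝ → ℝ := fun w => w * shiftSeries invGamma (a + 1) w * shiftSeries invGamma (-a) w
      + shiftSeries invGamma a w * shiftSeries invGamma (-a - 1) w with hQ
  have hd := hasDerivAt_shiftSeries geomGrowth_invGamma
  have hQ' : ∀ v, HasDerivAt Q 0 v := by
    intro v
    have h := (((hasDerivAt_id v).mul (hd (a + 1) v)).mul (hd (-a) v)).add
      ((hd a v).mul (hd (-a - 1) v))
    refine h.congr_deriv ?_
    have e1 := shiftSeries_invGamma_eq a v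
    have e2 := shiftSeries_invGamma_eq (-a - 1) v
    rw [show -a - 1 + 1 = -a by ring, show -a - 1 + 2 = -a + 1 by ring] at e2
    rw [show -a - 1 + 1 = -a by ring, show a + 1 + 1 = a + 2 by ring]
    simp only [id, Pi.mul_apply]
    linear_combination (-shiftSeries invGamma (-a) v) * e1 - shiftSeries invGamma (a + 1) v * e2
  have hconst := is_const_of_deriv_eq_zero (fun v => (hQ' v).differentiableAt)
    (fun v => (hQ' v).deriv) w 0
  change Q w = _
  rw [hconst]
  simp only [hQ, shiftSeries_zero, invGamma]
  have hr := Real.Gamma_mul_Gamma_one_sub (a + 1)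
  rw [show (1 : ℝ) - (a + 1) = -a by ring, show π * (a + 1) = a * π + π by ring,
    Real.sin_add_pi] at hr
  rw [show -a - 1 + 1 = -a by ring, zero_mul, zero_mul, zero_add, ← mul_inv, hr, inv_div, neg_div]

theorem besselJ_eq (a : ℝ) {x : ℝ} (hx : 0 < x) :
    besselJ a x = (x / 2) ^ a * shiftSeries invGamma a (x ^ 2 / 4) := by
  unfold besselJ shiftSeries
  rw [← tsum_mul_left]
  congr 1 with k
  have hx2 : 0 < x / 2 := by positivity
  rw [Real.rpow_add hx2, show (2 : ℝ) * k = ((2 * k : ℕ) : ℝ) by push_cast; ring,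
    Real.rpow_natCast, pow_mul, show (x / 2) ^ 2 = x ^ 2 / 4 by ring, neg_pow (x ^ 2 / 4), invGamma]
  have hk : (k.factorial : ℝ) ≠ 0 := by positivity
  rw [mul_comm (k.factorial : ℝ), ← div_div, div_eq_mul_inv _ (Real.Gamma _)]
  ring

theorem half_rpow_add_one (a : ℝ) {x : ℝ} (hx : 0 < x) :
    (x / 2) ^ (a + 1) = (x / 2) ^ a * (x / 2) := by
  rw [Real.rpow_add (by positivity), Real.rpow_one]

theorem half_rpow_add_two (a : ℝ) {x : ℝ} (hx : 0 < x) :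
    (x / 2) ^ (a + 2) = (x / 2) ^ a * (x ^ 2 / 4) := by
  rw [Real.rpow_add (by positivity), Real.rpow_two]
  ring

theorem hasDerivAt_half_rpow_mul_shiftSeries {c : ℝ → ℝ} (hc : GeomGrowth c) (a : ℝ) {x : ℝ}
    (hx : 0 < x) :
    HasDerivAt (fun x => (x / 2) ^ a * shiftSeries c a (x ^ 2 / 4))
      (a / x * ((x / 2) ^ a * shiftSeries c a (x ^ 2 / 4))
        - (x / 2) ^ (a + 1) * shiftSeries c (a + 1) (x ^ 2 / 4)) x := by
  have hx2 : x / 2 ≠ 0 := by positivity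
  have h1 := ((hasDerivAt_id x).div_const 2).rpow_const (p := a) (Or.inl hx2)
  have hsq : HasDerivAt (fun x : ℝ => x ^ 2 / 4) (x / 2) x :=
    ((hasDerivAt_pow 2 x).div_const 4).congr_deriv (by norm_num; ring)
  have h2 := (hasDerivAt_shiftSeries hc a (x ^ 2 / 4)).comp x hsq
  refine (h1.mul h2).congr_deriv ?_
  rw [half_rpow_add_one a hx]
  simp only [id, Function.comp_apply]
  rw [Real.rpow_sub_one hx2]
  field_simp
  ring

theorem hasDerivAt_besselJ (a : ℝ) {x : ℝ} (hx : 0 < x) :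
    HasDerivAt (besselJ a) (a / x * besselJ a x - besselJ (a + 1) x) x := by
  rw [besselJ_eq a hx, besselJ_eq (a + 1) hx]
  refine (hasDerivAt_half_rpow_mul_shiftSeries geomGrowth_invGamma a hx).congr_of_eventuallyEq ?_
  filter_upwards [lt_mem_nhds hx] with t ht using besselJ_eq a ht

theorem besselJ_rec (a : ℝ) {x : ℝ} (hx : 0 < x) :
    besselJ a x + besselJ (a + 2) x = 2 * (a + 1) / x * besselJ (a + 1) x := by
  rw [besselJ_eq a hx, besselJ_eq (a + 1) hx, besselJ_eq (a + 2) hx, half_rpow_add_one a hx,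
    half_rpow_add_two a hx, shiftSeries_invGamma_eq a]
  field_simp
  ring

/-- The derivative of `besselJ a x` with respect to the order `a`. -/
noncomputable def besselJOrderDeriv (a x : ℝ) : ℝ :=
  Real.log (x / 2) * besselJ a x + (x / 2) ^ a * shiftSeries (deriv invGamma) a (x ^ 2 / 4)

theorem hasDerivAt_besselJ_order (a : ℝ) {x : ℝ} (hx : 0 < x) :
    HasDerivAt (fun b => besselJ b x) (besselJOrderDeriv a x) a := by
  have h1 : HasDerivAt (fun b : ℝ => (x / 2) ^ b) (Real.log (x / 2) * 1 * (x / 2) ^ a) a :=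
    (hasDerivAt_id a).const_rpow (by positivity)
  have h := h1.mul (hasDerivAt_shiftSeries_param geomGrowth_invGamma geomGrowth_deriv_invGamma
    hasDerivAt_invGamma a (x ^ 2 / 4))
  have e : (fun b => besselJ b x) =
      fun b => (x / 2) ^ b * shiftSeries invGamma b (x ^ 2 / 4) := funext fun b => besselJ_eq b hx
  rw [e]
  refine h.congr_deriv ?_
  rw [besselJOrderDeriv, besselJ_eq a hx]
  ring

theorem hasDerivAt_besselJOrderDeriv (a : ℝ) {x : ℝ} (hx : 0 < x) :
    HasDerivAt (besselJOrderDeriv a)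
      (besselJ a x / x + a / x * besselJOrderDeriv a x - besselJOrderDeriv (a + 1) x) x := by
  have h1 : HasDerivAt (fun x : ℝ => Real.log (x / 2)) (1 / 2 / (x / 2)) x :=
    ((hasDerivAt_id x).div_const 2).log (by simpa using hx.ne')
  refine ((h1.mul (hasDerivAt_besselJ a hx)).add
    (hasDerivAt_half_rpow_mul_shiftSeries geomGrowth_deriv_invGamma a hx)).congr_deriv ?_
  unfold besselJOrderDeriv
  field_simp
  ring

theorem besselJOrderDeriv_rec (a : ℝ) {x : ℝ} (hx : 0 < x) :
    besselJOrderDeriv a x + besselJOrderDeriv (a + 2) x =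
      2 * (a + 1) / x * besselJOrderDeriv (a + 1) x + 2 / x * besselJ (a + 1) x := by
  have hd := fun b => hasDerivAt_besselJ_order b hx
  have h1 := (hd a).add ((hd (a + 2)).comp_add_const a 2)
  have h2 : HasDerivAt (fun b => 2 * (b + 1) / x * besselJ (b + 1) x)
      (2 * 1 / x * besselJ (a + 1) x + 2 * (a + 1) / x * besselJOrderDeriv (a + 1) x) a :=
    ((((hasDerivAt_id a).add_const 1).const_mul 2).div_const x).mul
      ((hd (a + 1)).comp_add_const a 1)
  have := h1.unique (h2.congr_of_eventuallyEq (.of_forall fun b => besselJ_rec b hx))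
  linear_combination this

theorem besselJ_neg_natCast (n : ℕ) {x : ℝ} (hx : 0 < x) :
    besselJ (-n) x = (-1) ^ n * besselJ n x := by
  induction n using Nat.twoStepInduction with
  | zero => simp
  | one =>
    have h := besselJ_rec (-1) hx
    norm_num at h ⊢
    linarith
  | more n ih1 ih2 =>
    have h1 := besselJ_rec (-((n + 2 : ℕ) : ℝ)) hx
    have h2 := besselJ_rec n hx
    push_cast at h1 ih2 ⊢
    rw [show -((n : ℝ) + 2) + 2 = -n by ring, show -((n : ℝ) + 2) + 1 = -(n + 1) by ring, ih1,
      ih2] at h1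
    rw [pow_succ] at h1
    rw [pow_add]
    linear_combination h1 - (-1) ^ n * h2

/-- The numerator in the definition of `besselY`. -/
noncomputable def besselYNum (x a : ℝ) : ℝ :=
  besselJ a x * Real.cos (a * π) - besselJ (-a) x

theorem hasDerivAt_besselYNum (a : ℝ) {x : ℝ} (hx : 0 < x) :
    HasDerivAt (besselYNum x) (besselJOrderDeriv a x * Real.cos (a * π)
      - besselJ a x * Real.sin (a * π) * π + besselJOrderDeriv (-a) x) a := by
  have h1 : HasDerivAt (fun b : ℝ => Real.cos (b * π)) (-Real.sin (a * π) * (1 * π)) a :=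
    ((hasDerivAt_id a).mul_const π).cos
  have h2 : HasDerivAt (fun b => besselJ (-b) x) (besselJOrderDeriv (-a) x * -1) a :=
    (hasDerivAt_besselJ_order (-a) hx).comp a (hasDerivAt_neg a)
  exact (((hasDerivAt_besselJ_order a hx).mul h1).sub h2).congr_deriv (by ring)

theorem hasDerivAt_sin_mul_pi (a : ℝ) :
    HasDerivAt (fun b : ℝ => Real.sin (b * π)) (Real.cos (a * π) * π) a :=
  (((hasDerivAt_id a).mul_const π).sin).congr_deriv (by simp)

instance nhdsWithin_nonint_neBot (a : ℝ) :
    (nhdsWithin a {b : ℝ | ∀ n : ℤ, b ≠ (n : ℝ)}).NeBot := by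
  rw [← mem_closure_iff_nhdsWithin_neBot]
  have h := (Set.countable_range ((↑) : ℤ → ℝ)).dense_compl ℝ a
  convert h using 3
  ext b
  simp [eq_comm]

theorem besselY_of_sin_ne_zero {a x : ℝ} (ha : Real.sin (a * π) ≠ 0) (hx : 0 < x) :
    besselY a x = besselYNum x a / Real.sin (a * π) := by
  refine Tendsto.limUnder_eq ?_
  exact ((hasDerivAt_besselYNum a hx).continuousAt.div
    (hasDerivAt_sin_mul_pi a).continuousAt ha).mono_left nhdsWithin_le_nhds

theorem besselYNum_natCast (n : ℕ) {x : ℝ} (hx : 0 < x) : besselYNum x n = 0 := by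
  rw [besselYNum, besselJ_neg_natCast n hx, Real.cos_nat_mul_pi]
  ring

theorem besselY_natCast (n : ℕ) {x : ℝ} (hx : 0 < x) :
    besselY n x = (besselJOrderDeriv n x + (-1) ^ n * besselJOrderDeriv (-n) x) / π := by
  refine Tendsto.limUnder_eq ?_
  have hle : nhdsWithin (n : ℝ) {b : ℝ | ∀ m : ℤ, b ≠ (m : ℝ)} ≤ nhdsWithin (n : ℝ) {(n : ℝ)}ᶜ :=
    nhdsWithin_mono _ fun b hb => by simpa using hb n
  have h1 := (hasDerivAt_besselYNum n hx).tendsto_slope.mono_left hle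
  have h2 := (hasDerivAt_sin_mul_pi n).tendsto_slope.mono_left hle
  have hsq : ((-1 : ℝ) ^ n) * (-1) ^ n = 1 := by rw [← mul_pow]; simp
  have hne : Real.cos (n * π) * π ≠ 0 := by
    rw [Real.cos_nat_mul_pi]
    exact mul_ne_zero (left_ne_zero_of_mul_eq_one hsq) Real.pi_ne_zero
  have h := h1.div h2 hne
  have hval : (besselJOrderDeriv n x * Real.cos (n * π) - besselJ n x * Real.sin (n * π) * π
      + besselJOrderDeriv (-n) x) / (Real.cos (n * π) * π) =
      (besselJOrderDeriv n x + (-1) ^ n * besselJOrderDeriv (-n) x) / π := by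
    rw [div_eq_div_iff hne Real.pi_ne_zero, Real.cos_nat_mul_pi, Real.sin_nat_mul_pi]
    linear_combination (-besselJOrderDeriv (-n) x * π) * hsq
  rw [hval] at h
  refine h.congr' ?_
  filter_upwards [hle self_mem_nhdsWithin] with b hb
  have hb' : b - n ≠ 0 := sub_ne_zero.2 hb
  simp only [Pi.div_apply, slope_def_field, besselYNum_natCast n hx, Real.sin_nat_mul_pi, sub_zero]
  rw [div_div_div_cancel_right₀ hb']
  rfl

theorem sin_mul_pi_ne_zero {a : ℝ} (ha : 0 ≤ a) (h : ¬∃ n : ℕ, a = n) : Real.sin (a * π) ≠ 0 := by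
  intro hs
  obtain ⟨m, hm⟩ := Real.sin_eq_zero_iff.1 hs
  have hm' : (m : ℝ) = a := mul_right_cancel₀ Real.pi_ne_zero hm
  have h0 : 0 ≤ m := by
    rw [← hm'] at ha
    exact_mod_cast ha
  exact h ⟨m.toNat, by rw [← hm', ← Int.cast_natCast, Int.toNat_of_nonneg h0]⟩

theorem hasDerivAt_besselY {a : ℝ} (ha : 0 ≤ a) {x : ℝ} (hx : 0 < x) :
    HasDerivAt (besselY a) (a / x * besselY a x - besselY (a + 1) x) x := by
  by_cases h : ∃ n : ℕ, a = n
  · obtain ⟨n, rfl⟩ := h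
    have hY : besselY n =ᶠ[𝓝 x] fun t =>
        (besselJOrderDeriv n t + (-1) ^ n * besselJOrderDeriv (-n) t) / π := by
      filter_upwards [lt_mem_nhds hx] with t ht using besselY_natCast n ht
    refine (((hasDerivAt_besselJOrderDeriv n hx).add
      ((hasDerivAt_besselJOrderDeriv (-n) hx).const_mul ((-1) ^ n))).div_const π
      ).congr_of_eventuallyEq hY |>.congr_deriv ?_
    have e1 := besselY_natCast (n + 1) hx
    have e2 := besselJOrderDeriv_rec (-((n + 1 : ℕ) : ℝ)) hx
    have e3 := besselJ_neg_natCast n hx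
    push_cast at e1 e2
    rw [show -((n : ℝ) + 1) + 2 = -n + 1 by ring, show -((n : ℝ) + 1) + 1 = -n by ring] at e2
    have hsq : ((-1 : ℝ) ^ n) * (-1) ^ n = 1 := by rw [← mul_pow]; simp
    rw [besselY_natCast n hx, e1, pow_succ, e3]
    rw [e3] at e2
    have hpi := Real.pi_ne_zero
    field_simp at e2 ⊢
    linear_combination (-(-1) ^ n) * e2 - besselJ n x * hsq
  · have hs := sin_mul_pi_ne_zero ha h
    have hs1 : Real.sin ((a + 1) * π) = -Real.sin (a * π) := by
      rw [add_one_mul, Real.sin_add_pi]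
    have hY : besselY a =ᶠ[𝓝 x] fun t =>
        (besselJ a t * Real.cos (a * π) - besselJ (-a) t) / Real.sin (a * π) := by
      filter_upwards [lt_mem_nhds hx] with t ht using besselY_of_sin_ne_zero hs ht
    refine ((((hasDerivAt_besselJ a hx).mul_const _).sub
      (hasDerivAt_besselJ (-a) hx)).div_const _).congr_of_eventuallyEq hY |>.congr_deriv ?_
    rw [besselY_of_sin_ne_zero hs hx, besselY_of_sin_ne_zero (by rwa [hs1, neg_ne_zero]) hx, hs1,
      besselYNum, besselYNum, add_one_mul, Real.cos_add_pi, neg_add']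
    have e := besselJ_rec (-a - 1) hx
    rw [show -a - 1 + 2 = -a + 1 by ring, show -a - 1 + 1 = -a by ring] at e
    field_simp at e ⊢
    linear_combination e

theorem besselY_rec {a : ℝ} (ha : 0 ≤ a) {x : ℝ} (hx : 0 < x) :
    besselY a x + besselY (a + 2) x = 2 * (a + 1) / x * besselY (a + 1) x := by
  by_cases h : ∃ n : ℕ, a = n
  · obtain ⟨n, rfl⟩ := h
    have e1 := besselY_natCast (n + 1) hx
    have e2 := besselY_natCast (n + 2) hx
    have r1 := besselJOrderDeriv_rec n hx
    have r2 := besselJOrderDeriv_rec (-((n + 2 : ℕ) : ℝ)) hx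
    have e3 := besselJ_neg_natCast (n + 1) hx
    push_cast at e1 e2 e3 r2
    rw [show -((n : ℝ) + 2) + 2 = -n by ring, show -((n : ℝ) + 2) + 1 = -(n + 1) by ring,
      e3] at r2
    have hsq : ((-1 : ℝ) ^ n) * (-1) ^ n = 1 := by rw [← mul_pow]; simp
    rw [besselY_natCast n hx, e1, e2]
    rw [pow_succ] at *
    have hpi := Real.pi_ne_zero
    field_simp at r1 r2 ⊢
    linear_combination r1 + (-1) ^ n * r2 - 2 * besselJ (n + 1) x * hsq
  · have hs := sin_mul_pi_ne_zero ha h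
    have hs1 : Real.sin ((a + 1) * π) = -Real.sin (a * π) := by
      rw [add_one_mul, Real.sin_add_pi]
    have hs2 : Real.sin ((a + 2) * π) = Real.sin (a * π) := by
      rw [add_mul, Real.sin_add_two_pi]
    have hs1' : Real.sin ((a + 1) * π) ≠ 0 := by rwa [hs1, neg_ne_zero]
    have hs2' : Real.sin ((a + 2) * π) ≠ 0 := by rwa [hs2]
    rw [besselY_of_sin_ne_zero hs hx, besselY_of_sin_ne_zero hs1' hx,
      besselY_of_sin_ne_zero hs2' hx, hs1, hs2, besselYNum, besselYNum, besselYNum,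
      add_one_mul, add_mul, Real.cos_add_pi, Real.cos_add_two_pi]
    have e1 := besselJ_rec a hx
    have e2 := besselJ_rec (-(a + 2)) hx
    rw [show -(a + 2) + 2 = -a by ring, show -(a + 2) + 1 = -(a + 1) by ring] at e2
    field_simp at e1 e2 ⊢
    linear_combination Real.cos (a * π) * e1 - e2

theorem besselYNum_wronskian (a : ℝ) {x : ℝ} (hx : 0 < x) :
    besselJ (a + 1) x * besselYNum x a + besselJ a x * besselYNum x (a + 1) =
      2 / (π * x) * Real.sin (a * π) := by
  have h := shiftSeries_wronskian a (x ^ 2 / 4)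
  have hinv : (x / 2) ^ (-a) * (x / 2) ^ a = 1 := by
    rw [← Real.rpow_add (by positivity)]; simp
  have hinv' : (x / 2) ^ (-a) = (x / 2) ^ (-a - 1) * (x / 2) := by
    rw [← half_rpow_add_one _ hx]; ring_nf
  rw [besselYNum, besselYNum, add_one_mul, Real.cos_add_pi, neg_add']
  rw [besselJ_eq a hx, besselJ_eq (a + 1) hx, besselJ_eq (-a) hx, besselJ_eq (-a - 1) hx,
    half_rpow_add_one a hx]
  have hpi := Real.pi_ne_zero
  have h1 : (x / 2) ^ (-a - 1) * (x / 2) ^ a = 2 / x := by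
    rw [hinv'] at hinv
    field_simp
    linear_combination 2 * hinv
  field_simp at h h1 ⊢
  linear_combination (-x ^ 2 * shiftSeries invGamma (a + 1) (x ^ 2 / 4) *
    shiftSeries invGamma (-a) (x ^ 2 / 4) * π) * hinv - h -
    2 * π * shiftSeries invGamma a (x ^ 2 / 4) * shiftSeries invGamma (-a - 1) (x ^ 2 / 4) * h1

theorem bessel_wronskian {a : ℝ} (ha : 0 ≤ a) {x : ℝ} (hx : 0 < x) :
    besselJ (a + 1) x * besselY a x - besselJ a x * besselY (a + 1) x = 2 / (π * x) := by
  have hpi := Real.pi_ne_zero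
  by_cases h : ∃ n : ℕ, a = n
  · obtain ⟨n, rfl⟩ := h
    have hJ := fun b => hasDerivAt_besselJ_order b hx
    have hN := fun b => hasDerivAt_besselYNum b hx
    have h1 := (((hJ (n + 1)).comp_add_const (n : ℝ) 1).mul (hN n)).add
      ((hJ n).mul ((hN (n + 1)).comp_add_const (n : ℝ) 1))
    have h2 := ((hasDerivAt_sin_mul_pi n).const_mul (2 / (π * x))).congr_of_eventuallyEq
      (.of_forall fun b => besselYNum_wronskian b hx)
    have e := h1.unique h2
    have e0 := besselYNum_natCast n hx
    have e1 := besselYNum_natCast (n + 1) hx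
    have y1 := besselY_natCast (n + 1) hx
    have hsq : ((-1 : ℝ) ^ n) * (-1) ^ n = 1 := by rw [← mul_pow]; simp
    push_cast at e1 y1
    rw [e0, e1, add_one_mul, Real.cos_add_pi, Real.sin_add_pi, Real.cos_nat_mul_pi,
      Real.sin_nat_mul_pi] at e
    rw [besselY_natCast n hx, y1, pow_succ]
    field_simp at e ⊢
    linear_combination (-1) ^ n * e - (x * besselJ (n + 1) x * besselJOrderDeriv n x -
      x * besselJ n x * besselJOrderDeriv (n + 1) x - 2) * hsq
  · have hs := sin_mul_pi_ne_zero ha h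
    have hs1 : Real.sin ((a + 1) * π) = -Real.sin (a * π) := by
      rw [add_one_mul, Real.sin_add_pi]
    have e := besselYNum_wronskian a hx
    rw [besselY_of_sin_ne_zero hs hx, besselY_of_sin_ne_zero (by rwa [hs1, neg_ne_zero]) hx, hs1]
    field_simp at e ⊢
    linear_combination e

theorem mul_pos_of_forall_ne_zero {f : ℝ → ℝ} {s : Set ℝ} (hs : IsPreconnected s)
    (hf : ContinuousOn f s) (hne : ∀ x ∈ s, f x ≠ 0) {x y : ℝ} (hx : x ∈ s) (hy : y ∈ s) :
    0 < f x * f y := by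
  by_contra! hlt
  rcases mul_nonpos_iff.1 hlt with ⟨h1, h2⟩ | ⟨h1, h2⟩
  · obtain ⟨z, hz, hz0⟩ := hs.intermediate_value hy hx hf ⟨h2, h1⟩
    exact hne z hz hz0
  · obtain ⟨z, hz, hz0⟩ := hs.intermediate_value hx hy hf ⟨h1, h2⟩
    exact hne z hz hz0

theorem HasDerivAt.mul_pos_of_zero_left {f : ℝ → ℝ} {d p q : ℝ} (hd : HasDerivAt f d p)
    (hp : f p = 0) (hd0 : d ≠ 0) (hpq : p < q) (hc : ContinuousOn f (Ioc p q))
    (hne : ∀ x ∈ Ioc p q, f x ≠ 0) : 0 < d * f q := by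
  have hq : q ∈ Ioc p q := ⟨hpq, le_rfl⟩
  have ht : Tendsto (slope f p) (𝓝[>] p) (𝓝 d) :=
    hd.tendsto_slope.mono_left (nhdsWithin_mono _ fun x hx => ne_of_gt hx)
  refine lt_of_le_of_ne ?_ (mul_ne_zero hd0 (hne q hq)).symm
  refine ge_of_tendsto (ht.mul_const (f q)) ?_
  filter_upwards [Ioo_mem_nhdsGT hpq] with x hx
  have := mul_pos_of_forall_ne_zero isPreconnected_Ioc hc hne ⟨hx.1, hx.2.le⟩ hq
  rw [slope_def_field, hp, sub_zero, div_mul_eq_mul_div]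
  exact div_nonneg this.le (sub_nonneg.2 hx.1.le)

theorem HasDerivAt.mul_neg_of_zero_right {f : ℝ → ℝ} {d p q : ℝ} (hd : HasDerivAt f d q)
    (hq : f q = 0) (hd0 : d ≠ 0) (hpq : p < q) (hc : ContinuousOn f (Ico p q))
    (hne : ∀ x ∈ Ico p q, f x ≠ 0) : d * f p < 0 := by
  have hp : p ∈ Ico p q := ⟨le_rfl, hpq⟩
  have ht : Tendsto (slope f q) (𝓝[<] q) (𝓝 d) :=
    hd.tendsto_slope.mono_left (nhdsWithin_mono _ fun x hx => ne_of_lt hx)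
  refine lt_of_le_of_ne ?_ (mul_ne_zero hd0 (hne p hp))
  refine le_of_tendsto (ht.mul_const (f p)) ?_
  filter_upwards [Ioo_mem_nhdsLT hpq] with x hx
  have := mul_pos_of_forall_ne_zero isPreconnected_Ico hc hne ⟨hx.1.le, hx.2⟩ hp
  rw [slope_def_field, hq, sub_zero, div_mul_eq_mul_div]
  exact div_nonpos_of_nonneg_of_nonpos this.le (sub_nonpos.2 hx.2.le)

/-- Two functions on `(0, ∞)` with simple zeros, such that `x` times their Wronskian has
derivative `K / x` times their product, as happens for solutions of two Bessel equations. -/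
structure BesselPair (K : ℝ) (f f' h h' : ℝ → ℝ) : Prop where
  ne_zero : K ≠ 0
  hasDerivAt_left : ∀ x, 0 < x → HasDerivAt f (f' x) x
  hasDerivAt_right : ∀ x, 0 < x → HasDerivAt h (h' x) x
  hasDerivAt_wronskian : ∀ x, 0 < x →
    HasDerivAt (fun t => t * (f t * h' t - f' t * h t)) (K / x * (f x * h x)) x
  simple_left : ∀ x, 0 < x → f x = 0 → f' x ≠ 0
  simple_right : ∀ x, 0 < x → h x = 0 → h' x ≠ 0

namespace BesselPair

variable {K : ℝ} {f f' h h' : ℝ → ℝ}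

theorem rotate (P : BesselPair K f f' h h') :
    BesselPair (-K) h h' (fun x => -f x) (fun x => -f' x) where
  ne_zero := neg_ne_zero.2 P.ne_zero
  hasDerivAt_left := P.hasDerivAt_right
  hasDerivAt_right x hx := (P.hasDerivAt_left x hx).fun_neg
  hasDerivAt_wronskian x hx := by
    refine ((P.hasDerivAt_wronskian x hx).congr_of_eventuallyEq
      (.of_forall fun t => ?_)).congr_deriv ?_ <;> ring
  simple_left := P.simple_right
  simple_right x hx h0 := neg_ne_zero.2 (P.simple_left x hx (neg_eq_zero.1 h0))

theorem continuousOn_left (P : BesselPair K f f' h h') {s : Set ℝ} (hs : ∀ x ∈ s, 0 < x) :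
    ContinuousOn f s :=
  fun x hx => (P.hasDerivAt_left x (hs x hx)).continuousAt.continuousWithinAt

theorem continuousOn_right (P : BesselPair K f f' h h') {s : Set ℝ} (hs : ∀ x ∈ s, 0 < x) :
    ContinuousOn h s :=
  P.rotate.continuousOn_left hs

theorem strictMonoOn_or_strictAntiOn (P : BesselPair K f f' h h') {s : Set ℝ} (hs : Convex ℝ s)
    (hpos : ∀ x ∈ s, 0 < x) (hf : ∀ x ∈ interior s, f x ≠ 0) (hh : ∀ x ∈ interior s, h x ≠ 0) :
    StrictMonoOn (fun t => t * (f t * h' t - f' t * h t)) s ∨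
      StrictAntiOn (fun t => t * (f t * h' t - f' t * h t)) s := by
  have hpos' : ∀ x ∈ interior s, 0 < x := fun x hx => hpos x (interior_subset hx)
  have hd : ∀ x ∈ interior s, HasDerivWithinAt (fun t => t * (f t * h' t - f' t * h t))
      (K / x * (f x * h x)) (interior s) x :=
    fun x hx => (P.hasDerivAt_wronskian x (hpos' x hx)).hasDerivWithinAt
  have hc : ContinuousOn (fun t => t * (f t * h' t - f' t * h t)) s :=
    fun x hx => (P.hasDerivAt_wronskian x (hpos x hx)).continuousAt.continuousWithinAt
  rcases hasDerivWithinAt_forall_lt_or_forall_gt_of_forall_ne hs.interior hd (m := 0)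
    (fun x hx => mul_ne_zero (div_ne_zero P.ne_zero (hpos' x hx).ne')
      (mul_ne_zero (hf x hx) (hh x hx))) with hneg | hpos
  · exact .inr (strictAntiOn_of_hasDerivWithinAt_neg hs hc hd hneg)
  · exact .inl (strictMonoOn_of_hasDerivWithinAt_pos hs hc hd hpos)

/-- Between a zero of one function and the following zero of the other one, the Wronskian keeps
its sign. -/
theorem wronskian_pos (P : BesselPair K f f' h h') {p q : ℝ} (hp : 0 < p) (hpq : p < q)
    (hfp : f p = 0) (hhq : h q = 0) (hf : ∀ x ∈ Ioc p q, f x ≠ 0) (hh : ∀ x ∈ Ico p q, h x ≠ 0)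
    (hW : 0 < f p * h' p - f' p * h p) {x : ℝ} (hx : x ∈ Icc p q) :
    0 < f x * h' x - f' x * h x := by
  have hq := hp.trans hpq
  have h1 := (P.hasDerivAt_left p hp).mul_pos_of_zero_left hfp (P.simple_left p hp hfp) hpq
    (P.continuousOn_left fun x hx => hp.trans hx.1) hf
  have h2 := (P.hasDerivAt_right q hq).mul_neg_of_zero_right hhq (P.simple_right q hq hhq) hpq
    (P.continuousOn_right fun x hx => hp.trans_le hx.1) hh
  rw [hfp, zero_mul, zero_sub] at hW
  have hWq : 0 < f q * h' q := by
    have h3 : 0 < (f' p * f q) * -(h' q * h p) := mul_pos h1 (neg_pos.2 h2)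
    rw [show (f' p * f q) * -(h' q * h p) = -(f' p * h p) * (f q * h' q) by ring] at h3
    exact pos_of_mul_pos_right h3 hW.le
  have hx0 : 0 < x := hp.trans_le hx.1
  have hp' : p ∈ Icc p q := left_mem_Icc.2 hpq.le
  have hq' : q ∈ Icc p q := right_mem_Icc.2 hpq.le
  refine pos_of_mul_pos_right (a := x) ?_ hx0.le
  rcases P.strictMonoOn_or_strictAntiOn (convex_Icc p q) (fun x hx => hp.trans_le hx.1)
    (fun x hx => hf x (by rw [interior_Icc] at hx; exact Ioo_subset_Ioc_self hx))
    (fun x hx => hh x (by rw [interior_Icc] at hx; exact Ioo_subset_Ico_self hx)) with hm | hm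
  · refine lt_of_lt_of_le ?_ (hm.monotoneOn hp' hx hx.1)
    simp only [hfp, zero_mul, zero_sub]
    exact mul_pos hp hW
  · refine lt_of_lt_of_le ?_ (hm.antitoneOn hx hq' hx.2)
    simp only [hhq, mul_zero, sub_zero]
    exact mul_pos hq hWq

theorem wronskian_pos' (P : BesselPair K f f' h h') {p q : ℝ} (hp : 0 < p) (hpq : p < q)
    (hhp : h p = 0) (hfq : f q = 0) (hh : ∀ x ∈ Ioc p q, h x ≠ 0) (hf : ∀ x ∈ Ico p q, f x ≠ 0)
    (hW : 0 < f p * h' p - f' p * h p) {x : ℝ} (hx : x ∈ Icc p q) :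
    0 < f x * h' x - f' x * h x := by
  have := P.rotate.wronskian_pos hp hpq hhp (neg_eq_zero.2 hfq) hh
    (fun t ht => neg_ne_zero.2 (hf t ht)) (by linarith) hx
  linarith

theorem hasDerivAt_div (P : BesselPair K f f' h h') {x : ℝ} (hx : 0 < x) (hh : h x ≠ 0) :
    HasDerivAt (fun t => f t / h t) (-(f x * h' x - f' x * h x) / h x ^ 2) x :=
  ((P.hasDerivAt_left x hx).fun_div (P.hasDerivAt_right x hx) hh).congr_deriv (by ring)

/-- The Wronskian is positive up to the first zero of the singular function. -/
theorem wronskian_pos_of_le_first_zero (P : BesselPair K f f' h h') {q : ℝ} (hq : 0 < q)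
    (hhq : h q = 0) (hf : ∀ x ∈ Ioc 0 q, 0 < f x) (hh : ∀ x ∈ Ioo 0 q, h x < 0)
    (hlim : Tendsto (fun x => f x / h x) (𝓝[>] 0) (𝓝 0)) {x : ℝ} (hx : x ∈ Ioc 0 q) :
    0 < f x * h' x - f' x * h x := by
  have hWq : 0 < f q * h' q := by
    have hq2 : q / 2 ∈ Ioo 0 q := ⟨by linarith, by linarith⟩
    have h2 := (P.hasDerivAt_right q hq).mul_neg_of_zero_right (p := q / 2) hhq
      (P.simple_right q hq hhq) hq2.2 (P.continuousOn_right fun x hx => hq2.1.trans_le hx.1)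
      (fun x hx => (hh x ⟨hq2.1.trans_le hx.1, hx.2⟩).ne)
    exact mul_pos (hf q ⟨hq, le_rfl⟩) (pos_of_mul_neg_left h2 (hh _ hq2).le)
  have hq' : q ∈ Ioc 0 q := ⟨hq, le_rfl⟩
  rcases hx.2.eq_or_lt with rfl | hxq
  · rwa [hhq, mul_zero, sub_zero]
  by_contra! hWx
  have hgx : x * (f x * h' x - f' x * h x) ≤ 0 := mul_nonpos_of_nonneg_of_nonpos hx.1.le hWx
  rcases P.strictMonoOn_or_strictAntiOn (convex_Ioc 0 q) (fun x hx => hx.1)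
    (fun x hx => (hf x (interior_subset hx)).ne')
    (fun x hx => (hh x (by rwa [interior_Ioc] at hx)).ne) with hm | hm
  · have hWneg : ∀ t ∈ Ioo 0 x, f t * h' t - f' t * h t < 0 := by
      intro t ht
      have h1 := (hm ⟨ht.1, ht.2.le.trans hx.2⟩ hx ht.2).trans_le hgx
      exact neg_of_mul_neg_right h1 ht.1.le
    have hmono : StrictMonoOn (fun t => f t / h t) (Ioo 0 x) := by
      have hd : ∀ t ∈ Ioo 0 x, HasDerivAt (fun t => f t / h t)
          (-(f t * h' t - f' t * h t) / h t ^ 2) t :=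
        fun t ht => P.hasDerivAt_div ht.1 (hh t ⟨ht.1, ht.2.trans hxq⟩).ne
      refine strictMonoOn_of_hasDerivWithinAt_pos (convex_Ioo 0 x)
        (fun t ht => (hd t ht).continuousAt.continuousWithinAt)
        (fun t ht => (hd t (interior_subset ht)).hasDerivWithinAt) fun t ht => ?_
      rw [interior_Ioo] at ht
      exact div_pos (neg_pos.2 (hWneg t ht))
        (even_two.pow_pos (hh t ⟨ht.1, ht.2.trans hxq⟩).ne)
    have hx2 : x / 2 ∈ Ioo 0 x := ⟨by linarith [hx.1], by linarith [hx.1]⟩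
    have hle : 0 ≤ f (x / 2) / h (x / 2) := by
      refine le_of_tendsto hlim ?_
      filter_upwards [Ioo_mem_nhdsGT hx2.1] with t ht
      exact (hmono ⟨ht.1, ht.2.trans hx2.2⟩ hx2 ht.2).le
    have hx2q : x / 2 < q := hx2.2.trans hxq
    exact hle.not_gt (div_neg_of_pos_of_neg (hf _ ⟨hx2.1, hx2q.le⟩) (hh _ ⟨hx2.1, hx2q⟩))
  · have h1 := (hm hx hq' hxq).trans_le hgx
    simp only [hhq, mul_zero, sub_zero] at h1
    exact h1.not_gt (mul_pos hq hWq)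

end BesselPair

namespace IsPosZeroSeq

variable {f : ℝ → ℝ} {z : ℕ → ℝ}

theorem le_of_le (hz : IsPosZeroSeq f z) {s t : ℕ} (hs : 1 ≤ s) (hst : s ≤ t) : z s ≤ z t := by
  rcases hst.eq_or_lt with rfl | h
  · rfl
  · exact (hz.mono s t hs h).le

theorem lt_of_lt (hz : IsPosZeroSeq f z) {s t : ℕ} (ht : 1 ≤ t) (h : z s < z t) : s < t := by
  by_contra! hle
  exact (hz.le_of_le ht hle).not_gt h

theorem ne_zero_of_lt_first (hz : IsPosZeroSeq f z) {x : ℝ} (hx : 0 < x) (hx1 : x < z 1) :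
    f x ≠ 0 := by
  intro h
  obtain ⟨t, ht, rfl⟩ := hz.complete x hx h
  exact (hz.le_of_le le_rfl ht).not_gt hx1

theorem ne_zero_of_mem_Ioo (hz : IsPosZeroSeq f z) {s : ℕ} (hs : 1 ≤ s) {x : ℝ}
    (hx : x ∈ Ioo (z s) (z (s + 1))) : f x ≠ 0 := by
  intro h
  obtain ⟨t, ht, rfl⟩ := hz.complete x ((hz.pos s hs).trans hx.1) h
  have h1 := hz.lt_of_lt ht hx.1
  have h2 := hz.lt_of_lt (Nat.le_add_left 1 s) hx.2
  omega

theorem exists_gt (hz : IsPosZeroSeq f z) {f' : ℝ → ℝ}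
    (hd : ∀ x, 0 < x → HasDerivAt f (f' x) x) (hs : ∀ x, 0 < x → f x = 0 → f' x ≠ 0) (x : ℝ) :
    ∃ s, 1 ≤ s ∧ x < z s := by
  by_contra! hle
  have hmono : StrictMono fun n => z (n + 1) :=
    strictMono_nat_of_lt_succ fun n => hz.mono _ _ (Nat.le_add_left 1 n) (Nat.lt_succ_self _)
  have hbdd : BddAbove (range fun n => z (n + 1)) :=
    ⟨x, by rintro _ ⟨n, rfl⟩; exact hle _ (Nat.le_add_left 1 n)⟩
  have ht := tendsto_atTop_ciSup hmono.monotone hbdd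
  set L := ⨆ n, z (n + 1)
  have hlt : ∀ n, z (n + 1) < L := fun n =>
    (hmono (Nat.lt_succ_self n)).trans_le (le_ciSup hbdd (n + 1))
  have hL : 0 < L := (hz.pos 1 le_rfl).trans (hlt 0)
  have hfz : ∀ n, f (z (n + 1)) = 0 := fun n => hz.isZero _ (Nat.le_add_left 1 n)
  have hfL : f L = 0 :=
    tendsto_nhds_unique (((hd L hL).continuousAt.tendsto.comp ht).congr hfz) tendsto_const_nhds
  have ht' : Tendsto (fun n => z (n + 1)) atTop (𝓝[≠] L) :=
    tendsto_nhdsWithin_iff.2 ⟨ht, .of_forall fun n => (hlt n).ne⟩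
  have hslope := ((hd L hL).tendsto_slope.comp ht').congr fun n =>
    show slope f L (z (n + 1)) = 0 by rw [slope_def_field, hfz, hfL, sub_zero, zero_div]
  exact hs L hL hfL (tendsto_nhds_unique hslope tendsto_const_nhds)

end IsPosZeroSeq

namespace BesselPair

variable {K : ℝ} {f f' h h' : ℝ → ℝ} {j y : ℕ → ℝ}

theorem wronskian_pos_of_interlacing (P : BesselPair K f f' h h')
    (hj : IsPosZeroSeq f j) (hy : IsPosZeroSeq h y)
    (hf0 : ∀ᶠ x in 𝓝[>] 0, 0 < f x) (hh0 : ∀ᶠ x in 𝓝[>] 0, h x < 0)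
    (hlim : Tendsto (fun x => f x / h x) (𝓝[>] 0) (𝓝 0))
    (hint : ∀ s : ℕ, 1 ≤ s → y s < j s ∧ j s < y (s + 1) ∧ y (s + 1) < j (s + 1))
    {x : ℝ} (hx : 0 < x) : 0 < f x * h' x - f' x * h x := by
  have hy1 := hy.pos 1 le_rfl
  have hyj := (hint 1 le_rfl).1
  have hpos : ∀ x ∈ Ioc 0 (y 1), 0 < f x * h' x - f' x * h x := by
    intro x hx
    refine P.wronskian_pos_of_le_first_zero hy1 (hy.isZero 1 le_rfl) ?_ ?_ hlim hx
    · intro t ht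
      obtain ⟨u, hu, hu'⟩ := (hf0.and (Ioo_mem_nhdsGT hy1)).exists
      have := mul_pos_of_forall_ne_zero isPreconnected_Ioc
        (P.continuousOn_left fun x hx => hx.1) (fun x (hx : x ∈ Ioc 0 (y 1)) =>
          hj.ne_zero_of_lt_first hx.1 (hx.2.trans_lt hyj)) ⟨hu'.1, hu'.2.le⟩ ht
      exact pos_of_mul_pos_right this hu.le
    · intro t ht
      obtain ⟨u, hu, hu'⟩ := (hh0.and (Ioo_mem_nhdsGT hy1)).exists
      have := mul_pos_of_forall_ne_zero isPreconnected_Ioo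
        (P.continuousOn_right fun x hx => hx.1) (fun x (hx : x ∈ Ioo 0 (y 1)) =>
          hy.ne_zero_of_lt_first hx.1 hx.2) hu' ht
      exact neg_of_mul_pos_right this hu.le
  have hstep : ∀ n : ℕ, ∀ x ∈ Ioc 0 (y (n + 1)), 0 < f x * h' x - f' x * h x := by
    intro n
    induction n with
    | zero => exact hpos
    | succ n ih =>
      have hn : 1 ≤ n + 1 := Nat.le_add_left 1 n
      obtain ⟨h1, h2, h3⟩ := hint (n + 1) hn
      have hyn := hy.pos _ hn
      have hfy : ∀ x ∈ Ico (y (n + 1)) (j (n + 1)), f x ≠ 0 := by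
        rintro x ⟨hx1, hx2⟩
        rcases Nat.eq_zero_or_pos n with rfl | hn0
        · exact hj.ne_zero_of_lt_first (hyn.trans_le hx1) hx2
        · exact hj.ne_zero_of_mem_Ioo hn0 ⟨(hint n hn0).2.1.trans_le hx1, hx2⟩
      have hA : ∀ x ∈ Icc (y (n + 1)) (j (n + 1)), 0 < f x * h' x - f' x * h x := fun x hx =>
        P.wronskian_pos' hyn h1 (hy.isZero _ hn) (hj.isZero _ hn)
          (fun t ht => hy.ne_zero_of_mem_Ioo hn ⟨ht.1, ht.2.trans_lt h2⟩) hfy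
          (ih _ ⟨hyn, le_rfl⟩) hx
      have hB : ∀ x ∈ Icc (j (n + 1)) (y (n + 1 + 1)), 0 < f x * h' x - f' x * h x := fun x hx =>
        P.wronskian_pos (hj.pos _ hn) h2 (hj.isZero _ hn) (hy.isZero _ (Nat.le_add_left 1 _))
          (fun t ht => hj.ne_zero_of_mem_Ioo hn ⟨ht.1, ht.2.trans_lt h3⟩)
          (fun t ht => hy.ne_zero_of_mem_Ioo hn ⟨h1.trans_le ht.1, ht.2⟩)
          (hA _ ⟨h1.le, le_rfl⟩) hx
      intro x hx
      rcases le_total x (y (n + 1)) with hx1 | hx1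
      · exact ih x ⟨hx.1, hx1⟩
      rcases le_total x (j (n + 1)) with hx2 | hx2
      · exact hA x ⟨hx1, hx2⟩
      · exact hB x ⟨hx2, hx.2⟩
  obtain ⟨s, hs, hxs⟩ := hy.exists_gt P.hasDerivAt_right P.simple_right x
  obtain ⟨n, rfl⟩ := Nat.exists_eq_add_of_le' hs
  exact hstep n x ⟨hx, hxs.le⟩

theorem exists_zero_right (P : BesselPair K f f' h h')
    (hW : ∀ x, 0 < x → f x * h' x - f' x * h x ≠ 0) {p q : ℝ} (hp : 0 ≤ p) (hpq : p < q)
    (hlim : Tendsto (fun x => f x / h x) (𝓝[>] p) (𝓝 0)) (hq : f q = 0) :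
    ∃ x ∈ Ioo p q, h x = 0 := by
  by_contra! hne
  have hq0 := hp.trans_lt hpq
  have hhq : h q ≠ 0 := fun h0 => hW q hq0 (by simp [hq, h0])
  have hlim' : Tendsto (fun x => f x / h x) (𝓝[<] q) (𝓝 0) := by
    have := (P.hasDerivAt_div hq0 hhq).continuousAt.tendsto.mono_left
      (nhdsWithin_le_nhds (s := Iio q))
    rwa [hq, zero_div] at this
  obtain ⟨x, hx, hx0⟩ := exists_hasDerivAt_eq_zero' hpq hlim hlim' fun x hx =>
    P.hasDerivAt_div (hp.trans_lt hx.1) (hne x hx)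
  exact div_ne_zero (neg_ne_zero.2 (hW x (hp.trans_lt hx.1))) (pow_ne_zero 2 (hne x hx)) hx0

theorem exists_zero_right_of_zeros (P : BesselPair K f f' h h')
    (hW : ∀ x, 0 < x → f x * h' x - f' x * h x ≠ 0) {p q : ℝ} (hp : 0 < p) (hpq : p < q)
    (hfp : f p = 0) (hq : f q = 0) : ∃ x ∈ Ioo p q, h x = 0 := by
  refine P.exists_zero_right hW hp.le hpq ?_ hq
  have hhp : h p ≠ 0 := fun h0 => hW p hp (by simp [hfp, h0])
  have := (P.hasDerivAt_div hp hhp).continuousAt.tendsto.mono_left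
    (nhdsWithin_le_nhds (s := Ioi p))
  rwa [hfp, zero_div] at this

theorem exists_zero_left_of_zeros (P : BesselPair K f f' h h')
    (hW : ∀ x, 0 < x → f x * h' x - f' x * h x ≠ 0) {p q : ℝ} (hp : 0 < p) (hpq : p < q)
    (hhp : h p = 0) (hq : h q = 0) : ∃ x ∈ Ioo p q, f x = 0 := by
  obtain ⟨x, hx, hx0⟩ := P.rotate.exists_zero_right_of_zeros
    (fun x hx h0 => hW x hx (by linarith)) hp hpq hhp hq
  exact ⟨x, hx, neg_eq_zero.1 hx0⟩

theorem interlacing_of_wronskian_ne_zero (P : BesselPair K f f' h h')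
    (hj : IsPosZeroSeq f j) (hy : IsPosZeroSeq h y)
    (hlim : Tendsto (fun x => f x / h x) (𝓝[>] 0) (𝓝 0))
    (hW : ∀ x, 0 < x → f x * h' x - f' x * h x ≠ 0) {s : ℕ} (hs : 1 ≤ s) :
    y s < j s ∧ j s < y (s + 1) ∧ y (s + 1) < j (s + 1) := by
  have hfirst : y 1 < j 1 := by
    obtain ⟨x, hx, hx0⟩ := P.exists_zero_right hW le_rfl (hj.pos 1 le_rfl) hlim
      (hj.isZero 1 le_rfl)
    obtain ⟨t, ht, rfl⟩ := hy.complete x hx.1 hx0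
    exact (hy.le_of_le le_rfl ht).trans_lt hx.2
  have hjj : ∀ {s}, 1 ≤ s → y s < j s → y (s + 1) < j (s + 1) := by
    intro s hs h1
    obtain ⟨x, hx, hx0⟩ := P.exists_zero_right_of_zeros hW (hj.pos s hs)
      (hj.mono s (s + 1) hs s.lt_succ_self) (hj.isZero s hs) (hj.isZero _ (Nat.le_add_left 1 s))
    obtain ⟨t, ht, rfl⟩ := hy.complete x ((hj.pos s hs).trans hx.1) hx0
    have := hy.lt_of_lt ht (h1.trans hx.1)
    exact (hy.le_of_le (Nat.le_add_left 1 s) this).trans_lt hx.2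
  have hlt : ∀ n : ℕ, y (n + 1) < j (n + 1) := by
    intro n
    induction n with
    | zero => exact hfirst
    | succ n ih => exact hjj (Nat.le_add_left 1 n) ih
  have hyy : ∀ n : ℕ, j (n + 1) < y (n + 1 + 1) := by
    have hstep : ∀ n : ℕ, (∀ t, 1 ≤ t → y (n + 1) < j t → n + 1 ≤ t) →
        j (n + 1) < y (n + 1 + 1) := by
      intro n hmin
      have hn : 1 ≤ n + 1 := Nat.le_add_left 1 n
      obtain ⟨x, hx, hx0⟩ := P.exists_zero_left_of_zeros hW (hy.pos _ hn)
        (hy.mono _ (n + 1 + 1) hn (Nat.lt_succ_self _)) (hy.isZero _ hn)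
        (hy.isZero _ (Nat.le_add_left 1 _))
      obtain ⟨t, ht, rfl⟩ := hj.complete x ((hy.pos _ hn).trans hx.1) hx0
      exact (hj.le_of_le hn (hmin t ht hx.1)).trans_lt hx.2
    intro n
    induction n with
    | zero => exact hstep 0 fun t ht _ => ht
    | succ n ih => exact hstep (n + 1) fun t ht hlt => hj.lt_of_lt ht (ih.trans hlt)
  obtain ⟨n, rfl⟩ := Nat.exists_eq_add_of_le' hs
  exact ⟨hlt n, hyy n, hlt (n + 1)⟩

end BesselPair

theorem besselJ_bounds_near_zero {a : ℝ} (ha : 0 ≤ a) :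
    ∀ᶠ x in 𝓝[>] 0, invGamma a / 2 * (x / 2) ^ a ≤ besselJ a x ∧
      besselJ a x ≤ 2 * invGamma a * (x / 2) ^ a := by
  have hpos := invGamma_pos ha
  have hc : ContinuousAt (fun x => shiftSeries invGamma a (x ^ 2 / 4)) 0 :=
    (hasDerivAt_shiftSeries geomGrowth_invGamma a _).continuousAt.comp (f := fun x : ℝ => x ^ 2 / 4)
      (by fun_prop)
  have ht : Tendsto (fun x => shiftSeries invGamma a (x ^ 2 / 4)) (𝓝[>] 0) (𝓝 (invGamma a)) := by
    simpa [ContinuousAt, shiftSeries_zero] using hc.tendsto.mono_left (nhdsWithin_le_nhds (s := Ioi 0))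
  filter_upwards [self_mem_nhdsWithin, ht.eventually (Ioo_mem_nhds (half_lt_self hpos)
    (by linarith : invGamma a < 2 * invGamma a))] with x hx hS
  have hx2 : 0 ≤ (x / 2) ^ a := Real.rpow_nonneg (half_pos hx).le a
  rw [besselJ_eq a hx, mul_comm ((x / 2) ^ a)]
  exact ⟨mul_le_mul_of_nonneg_right hS.1.le hx2, mul_le_mul_of_nonneg_right hS.2.le hx2⟩

theorem besselJ_pos_near_zero {a : ℝ} (ha : 0 ≤ a) : ∀ᶠ x in 𝓝[>] 0, 0 < besselJ a x := by
  filter_upwards [self_mem_nhdsWithin, besselJ_bounds_near_zero ha] with x hx h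
  exact (mul_pos (half_pos (invGamma_pos ha)) (Real.rpow_pos_of_pos (half_pos hx) a)).trans_le h.1

theorem abs_besselJ_le_near_zero {a : ℝ} (ha : 0 ≤ a) :
    ∀ᶠ x in 𝓝[>] 0, |besselJ a x| ≤ 2 * invGamma a := by
  filter_upwards [Ioo_mem_nhdsGT (zero_lt_two' ℝ), besselJ_bounds_near_zero ha,
    besselJ_pos_near_zero ha] with x hx h hpos
  rw [abs_of_pos hpos]
  refine h.2.trans (mul_le_of_le_one_right (by linarith [invGamma_pos ha]) ?_)
  exact Real.rpow_le_one (by linarith [hx.1]) (by linarith [hx.2]) ha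

theorem hasDerivAt_besselY_div_besselJ {a : ℝ} (ha : 0 ≤ a) {x : ℝ} (hx : 0 < x)
    (hJ : besselJ a x ≠ 0) :
    HasDerivAt (fun t => besselY a t / besselJ a t) (2 / (π * x) / besselJ a x ^ 2) x := by
  refine ((hasDerivAt_besselY ha hx).fun_div (hasDerivAt_besselJ a hx) hJ).congr_deriv ?_
  rw [← bessel_wronskian ha hx]
  ring

theorem tendsto_besselY_atBot {a : ℝ} (ha : 0 ≤ a) : Tendsto (besselY a) (𝓝[>] 0) atBot := by
  set M := 2 * invGamma a with hM
  have hMpos : 0 < M := by have := invGamma_pos ha; positivity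
  set k := 2 / (π * M ^ 2) with hk
  have hkpos : 0 < k := by positivity
  set φ : ℝ → ℝ := fun x => k * ((x / 2) ^ (-a) * Real.log (x / 2)) with hφ
  obtain ⟨ε, hε, hball⟩ := mem_nhdsGT_iff_exists_Ioo_subset.1
    ((besselJ_bounds_near_zero ha).and (besselJ_pos_near_zero ha))
  have hε0 : 0 < ε := hε
  have hφ' : ∀ x, 0 < x → HasDerivAt φ (k / x * ((x / 2) ^ (-a) * (1 - a * Real.log (x / 2)))) x := by
    intro x hx
    have hx2 : x / 2 ≠ 0 := by positivity
    have h1 := (((hasDerivAt_id x).div_const 2).rpow_const (p := -a) (Or.inl hx2))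
    have h2 := ((hasDerivAt_id x).div_const 2).log hx2
    refine ((h1.mul h2).const_mul k).congr_deriv ?_
    simp only [id]
    rw [Real.rpow_sub_one hx2]
    field_simp
    ring
  have hd : ∀ x ∈ Ioo 0 ε, HasDerivAt (fun x => besselY a x / besselJ a x - φ x)
      (2 / (π * x) / besselJ a x ^ 2 -
        k / x * ((x / 2) ^ (-a) * (1 - a * Real.log (x / 2)))) x := fun x hx =>
    (hasDerivAt_besselY_div_besselJ ha hx.1 (hball hx).2.ne').sub (hφ' x hx.1)
  have hmono : MonotoneOn (fun x => besselY a x / besselJ a x - φ x) (Ioo 0 ε) := by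
    refine monotoneOn_of_hasDerivWithinAt_nonneg (convex_Ioo 0 ε)
      (fun x hx => (hd x hx).continuousAt.continuousWithinAt)
      (fun x hx => (hd x (interior_subset hx)).hasDerivWithinAt) fun x hx => ?_
    rw [interior_Ioo] at hx
    obtain ⟨⟨-, hJ⟩, hJ0⟩ := hball hx
    have hx0 : 0 < x := hx.1
    have hx2 : 0 < x / 2 := half_pos hx.1
    have hpow : 0 < (x / 2) ^ a := Real.rpow_pos_of_pos hx2 a
    have hexp : 1 - a * Real.log (x / 2) ≤ (x / 2) ^ (-a) := by
      rw [Real.rpow_def_of_pos hx2]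
      linarith [Real.add_one_le_exp (Real.log (x / 2) * -a)]
    have hneg : (x / 2) ^ (-a) = ((x / 2) ^ a)⁻¹ := Real.rpow_neg hx2.le a
    rw [sub_nonneg]
    calc k / x * ((x / 2) ^ (-a) * (1 - a * Real.log (x / 2)))
        ≤ k / x * ((x / 2) ^ (-a) * (x / 2) ^ (-a)) := by
          have : 0 < (x / 2) ^ (-a) := Real.rpow_pos_of_pos hx2 _
          gcongr
      _ = 2 / (π * x) / (M * (x / 2) ^ a) ^ 2 := by
          rw [hneg, hk]
          field_simp
      _ ≤ 2 / (π * x) / besselJ a x ^ 2 := by gcongr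
  set C := besselY a (ε / 2) / besselJ a (ε / 2) - φ (ε / 2)
  have hlog : Tendsto (fun x : ℝ => Real.log (x / 2)) (𝓝[>] 0) atBot := by
    have : Tendsto (fun x => Real.log x - Real.log 2) (𝓝[>] 0) atBot :=
      tendsto_atBot_add_const_right _ _ Real.tendsto_log_nhdsGT_zero
    refine this.congr' ?_
    filter_upwards [self_mem_nhdsWithin] with x hx
    rw [Real.log_div (ne_of_gt hx) two_ne_zero]
  have hbound : Tendsto (fun x => invGamma a / 2 * k * Real.log (x / 2) + |C| * M) (𝓝[>] 0) atBot :=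
    tendsto_atBot_add_const_right _ _ (hlog.const_mul_atBot
      (mul_pos (half_pos (invGamma_pos ha)) hkpos))
  refine tendsto_atBot_mono' _ ?_ hbound
  filter_upwards [Ioo_mem_nhdsGT (zero_lt_two' ℝ), Ioo_mem_nhdsGT (half_pos hε0),
    abs_besselJ_le_near_zero ha] with x hx hxε hJM
  have hxε' : x ∈ Ioo 0 ε := ⟨hx.1, hxε.2.trans (half_lt_self hε0)⟩
  obtain ⟨⟨hJ, -⟩, hJ0⟩ := hball hxε'
  have hle := hmono hxε' ⟨half_pos hε0, half_lt_self hε0⟩ hxε.2.le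
  have hx2 : 0 < x / 2 := half_pos hx.1
  have hpow : (x / 2) ^ a ≠ 0 := (Real.rpow_pos_of_pos hx2 a).ne'
  have hY : besselY a x = besselJ a x * (besselY a x / besselJ a x) := by field_simp
  have hφ0 : φ x ≤ 0 := mul_nonpos_of_nonneg_of_nonpos hkpos.le
    (mul_nonpos_of_nonneg_of_nonpos (Real.rpow_nonneg hx2.le _)
      (Real.log_nonpos hx2.le (by linarith [hx.2])))
  calc besselY a x = besselJ a x * (besselY a x / besselJ a x) := hY
    _ ≤ besselJ a x * (φ x + C) := by
        refine mul_le_mul_of_nonneg_left ?_ hJ0.le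
        change _ - φ x ≤ C at hle
        linarith
    _ = besselJ a x * φ x + C * besselJ a x := by ring
    _ ≤ invGamma a / 2 * (x / 2) ^ a * φ x + |C| * M :=
        add_le_add (mul_le_mul_of_nonpos_right hJ hφ0)
          (mul_le_mul (le_abs_self C) ((le_abs_self _).trans hJM) hJ0.le (abs_nonneg C))
    _ = invGamma a / 2 * k * Real.log (x / 2) + |C| * M := by
        simp only [hφ, Real.rpow_neg hx2.le]
        field_simp

theorem tendsto_besselJ_div_besselY {ν μ : ℝ} (hν : 0 ≤ ν) (hμ : 0 ≤ μ) :
    Tendsto (fun x => besselJ ν x / besselY μ x) (𝓝[>] 0) (𝓝 0) := by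
  simp only [div_eq_mul_inv]
  exact bdd_le_mul_tendsto_zero' _ (abs_besselJ_le_near_zero hν)
    (tendsto_inv_atBot_zero.comp (tendsto_besselY_atBot hμ))

theorem deriv_besselJ_ne_zero {a : ℝ} (ha : 0 ≤ a) {x : ℝ} (hx : 0 < x) (h : besselJ a x = 0) :
    deriv (besselJ a) x ≠ 0 := by
  intro h'
  have hW := bessel_wronskian ha hx
  rw [(hasDerivAt_besselJ a hx).deriv, h, mul_zero, zero_sub, neg_eq_zero] at h'
  rw [h, h', zero_mul, zero_mul, sub_zero] at hW
  exact (by positivity : 2 / (π * x) ≠ 0) hW.symm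

theorem deriv_besselY_ne_zero {a : ℝ} (ha : 0 ≤ a) {x : ℝ} (hx : 0 < x) (h : besselY a x = 0) :
    deriv (besselY a) x ≠ 0 := by
  intro h'
  have hW := bessel_wronskian ha hx
  rw [(hasDerivAt_besselY ha hx).deriv, h, mul_zero, zero_sub, neg_eq_zero] at h'
  rw [h, h', mul_zero, mul_zero, sub_zero] at hW
  exact (by positivity : 2 / (π * x) ≠ 0) hW.symm

theorem besselPair_besselJ_besselY {ν μ : ℝ} (hν : 0 ≤ ν) (hμ : 0 ≤ μ) (hne : ν ≠ μ) :
    BesselPair (μ ^ 2 - ν ^ 2) (besselJ ν) (deriv (besselJ ν)) (besselY μ)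
      (deriv (besselY μ)) where
  ne_zero h := hne ((pow_left_inj₀ hν hμ two_ne_zero).1 (sub_eq_zero.1 h).symm)
  hasDerivAt_left _ hx := (hasDerivAt_besselJ ν hx).differentiableAt.hasDerivAt
  hasDerivAt_right _ hx := (hasDerivAt_besselY hμ hx).differentiableAt.hasDerivAt
  hasDerivAt_wronskian x hx := by
    have hμ1 : 0 ≤ μ + 1 := by linarith
    have hJ := hasDerivAt_besselJ ν hx
    have hJ1 := hasDerivAt_besselJ (ν + 1) hx
    have hY := hasDerivAt_besselY hμ hx
    have hY1 := hasDerivAt_besselY hμ1 hx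
    have rJ := besselJ_rec ν hx
    have rY := besselY_rec hμ hx
    have h := ((hJ.const_mul (μ - ν)).mul hY).add
      ((hasDerivAt_id x).mul ((hJ1.mul hY).sub (hJ.mul hY1)))
    refine (h.congr_of_eventuallyEq ?_).congr_deriv ?_
    · filter_upwards [lt_mem_nhds hx] with t ht
      rw [(hasDerivAt_besselJ ν ht).deriv, (hasDerivAt_besselY hμ ht).deriv]
      simp only [Pi.add_apply, Pi.mul_apply, Pi.sub_apply, id]
      field_simp
      ring
    · simp only [Pi.mul_apply, Pi.sub_apply, id]
      rw [show ν + 1 + 1 = ν + 2 by ring, show μ + 1 + 1 = μ + 2 by ring]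
      rw [← eq_sub_iff_add_eq'] at rJ rY
      rw [rJ, rY]
      field_simp
      ring
  simple_left _ hx h := deriv_besselJ_ne_zero hν hx h
  simple_right _ hx h := deriv_besselY_ne_zero hμ hx h

/-- Equivalence of the interlacing `y_{μ,s} < j_{ν,s} < y_{μ,s+1} < j_{ν,s+1}`
for all `s ≥ 1` with the nonvanishing of the mixed Wronskian
`W_{νμ}(x) = J_ν(x)·Y'_μ(x) − J'_ν(x)·Y_μ(x)` on `(0, ∞)`. -/
theorem interlacing_iff_mixed_wronskian_ne_zero (ν μ : ℝ)
    (hν : 0 ≤ ν) (hμ : 0 ≤ μ) (hne : ν ≠ μ)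
    (j y : ℕ → ℝ)
    (hj : IsPosZeroSeq (besselJ ν) j)
    (hy : IsPosZeroSeq (besselY μ) y) :
    (∀ s : ℕ, 1 ≤ s →
        y s < j s ∧ j s < y (s + 1) ∧ y (s + 1) < j (s + 1))
      ↔ (∀ x : ℝ, 0 < x →
          besselJ ν x * deriv (besselY μ) x - deriv (besselJ ν) x * besselY μ x ≠ 0) := by
  have P := besselPair_besselJ_besselY hν hμ hne
  have hlim := tendsto_besselJ_div_besselY hν hμ
  constructor
  · intro h x hx
    exact (P.wronskian_pos_of_interlacing hj hy (besselJ_pos_near_zero hν)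
      ((tendsto_besselY_atBot hμ).eventually_lt_atBot 0) hlim h hx).ne'
  · intro hW s hs
    exact P.interlacing_of_wronskian_ne_zero hj hy hlim hW hs
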